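/- If 𝕃₁ and 𝕃₂ are sets of inferences with 𝕃₁ = Tar(𝕃₁) and 𝕃₂ = Tar(𝕃₂), then T(𝕃₁ ∪ 𝕃₂) = Tar(𝕃₁ ∪ 𝕃₂). -/

import Mathlib

namespace ThreeValued

/-- Formulas of the propositional language: countably many variables,
negation, conjunction, disjunction. -/
inductive Fml : Type
  | var : ℕ → Fml
  | neg : Fml → Fml
  | conj : Fml → Fml → Fml
  | disj : Fml → Fml → Fml
deriving DecidableEq

/-- An inference Γ ⇒ φ: a finite set of premises and a conclusion. -/
structure Infer : Type where
  prem : Finset Fml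
  concl : Fml

/-- A set of inferences is closed under transitivity:
whenever there is a nonempty Δ with Δ ⇒ φ ∈ L and Γ ⇒ δ ∈ L for all δ ∈ Δ,
then Γ ⇒ φ ∈ L. -/
def TransClosed (L : Set Infer) : Prop :=
  ∀ (Γ Δ : Finset Fml) (φ : Fml), Δ.Nonempty →
    (⟨Δ, φ⟩ : Infer) ∈ L → (∀ δ ∈ Δ, (⟨Γ, δ⟩ : Infer) ∈ L) → (⟨Γ, φ⟩ : Infer) ∈ L

/-- The transitive closure of a set of inferences: the least superset closed
under transitivity. -/
def T (L : Set Infer) : Set Infer := ⋂₀ {L' : Set Infer | L ⊆ L' ∧ TransClosed L'}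

/-- A set of inferences is open under dual transitivity:
whenever there is a nonempty Δ with Δ ⇒ φ ∉ L and Γ ⇒ δ ∉ L for all δ ∈ Δ,
then Γ ⇒ φ ∉ L. -/
def DualTransClosed (L : Set Infer) : Prop :=
  ∀ (Γ Δ : Finset Fml) (φ : Fml), Δ.Nonempty →
    (⟨Δ, φ⟩ : Infer) ∉ L → (∀ δ ∈ Δ, (⟨Γ, δ⟩ : Infer) ∉ L) → (⟨Γ, φ⟩ : Infer) ∉ L

/-- The dual transitive closure: the greatest subset open under dual
transitivity. -/
def Td (L : Set Infer) : Set Infer := ⋃₀ {L' : Set Infer | L' ⊆ L ∧ DualTransClosed L'}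

/-- The three truth values 0, 1/2, 1. -/
inductive V3 : Type
  | zero | half | one
deriving DecidableEq

/-- A three-valued scheme: a triple of truth functions for ¬, ∧ and ∨. -/
structure Scheme : Type where
  fneg : V3 → V3
  fconj : V3 → V3 → V3
  fdisj : V3 → V3 → V3

/-- Boolean normality: on Boolean inputs the operations agree with the
classical ones. -/
def BooleanNormal (X : Scheme) : Prop :=
  X.fneg .zero = .one ∧ X.fneg .one = .zero ∧
  X.fconj .one .one = .one ∧ X.fconj .one .zero = .zero ∧
  X.fconj .zero .one = .zero ∧ X.fconj .zero .zero = .zero ∧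
  X.fdisj .one .one = .one ∧ X.fdisj .one .zero = .one ∧
  X.fdisj .zero .one = .one ∧ X.fdisj .zero .zero = .zero

/-- The information order: 1/2 is below 0 and below 1. -/
def infLe (a b : V3) : Prop := a = .half ∨ a = b

/-- Monotonicity of a scheme with respect to the information order. -/
def Monotonic (X : Scheme) : Prop :=
  (∀ a b, infLe a b → infLe (X.fneg a) (X.fneg b)) ∧
  (∀ a₁ a₂ b₁ b₂, infLe a₁ b₁ → infLe a₂ b₂ → infLe (X.fconj a₁ a₂) (X.fconj b₁ b₂)) ∧
  (∀ a₁ a₂ b₁ b₂, infLe a₁ b₁ → infLe a₂ b₂ → infLe (X.fdisj a₁ a₂) (X.fdisj b₁ b₂))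

/-- Boolean normal monotonic schemes. -/
def BNM (X : Scheme) : Prop := BooleanNormal X ∧ Monotonic X

/-- Valuations respecting a scheme. -/
def Respects (X : Scheme) (v : Fml → V3) : Prop :=
  (∀ φ, v (.neg φ) = X.fneg (v φ)) ∧
  (∀ φ ψ, v (.conj φ ψ) = X.fconj (v φ) (v ψ)) ∧
  (∀ φ ψ, v (.disj φ ψ) = X.fdisj (v φ) (v ψ))

/-- The strict formula-standard s = {1}. -/
def sStd : Set V3 := {.one}

/-- The tolerant formula-standard t = {1, 1/2}. -/
def tStd : Set V3 := {.one, .half}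

/-- An inference is xy-valid over a scheme X if every valuation respecting X
whose value on each premise is in x gives the conclusion a value in y. -/
def Valid (X : Scheme) (x y : Set V3) (I : Infer) : Prop :=
  ∀ v : Fml → V3, Respects X v → (∀ γ ∈ I.prem, v γ ∈ x) → v I.concl ∈ y

/-- The ss-valid inferences over X. -/
def SS (X : Scheme) : Set Infer := {I | Valid X sStd sStd I}

/-- The tt-valid inferences over X. -/
def TT (X : Scheme) : Set Infer := {I | Valid X tStd tStd I}

/-- The st-valid inferences over X. -/
def ST (X : Scheme) : Set Infer := {I | Valid X sStd tStd I}

/-- The ts-valid inferences over X. -/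
def TS (X : Scheme) : Set Infer := {I | Valid X tStd sStd I}

/-- Classical two-valued valuations. -/
def RespectsCL (v : Fml → Bool) : Prop :=
  (∀ φ, v (.neg φ) = ! v φ) ∧
  (∀ φ ψ, v (.conj φ ψ) = (v φ && v ψ)) ∧
  (∀ φ ψ, v (.disj φ ψ) = (v φ || v ψ))

/-- The classically valid inferences. -/
def CL : Set Infer :=
  {I | ∀ v : Fml → Bool, RespectsCL v → (∀ γ ∈ I.prem, v γ = true) → v I.concl = true}

/-- Substitution: the homomorphic extension of a map from variables to
formulas. -/
def subst (σ : ℕ → Fml) : Fml → Fml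
  | .var n => σ n
  | .neg φ => .neg (subst σ φ)
  | .conj φ ψ => .conj (subst σ φ) (subst σ ψ)
  | .disj φ ψ => .disj (subst σ φ) (subst σ ψ)

/-- Reflexivity. -/
def PropR (L : Set Infer) : Prop := ∀ φ : Fml, (⟨{φ}, φ⟩ : Infer) ∈ L

/-- Monotonicity (weakening). -/
def PropM (L : Set Infer) : Prop :=
  ∀ (Γ Sg : Finset Fml) (φ : Fml), (⟨Γ, φ⟩ : Infer) ∈ L → Γ ⊆ Sg → (⟨Sg, φ⟩ : Infer) ∈ L

/-- Structurality (closure under substitutions). -/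
def PropS (L : Set Infer) : Prop :=
  ∀ (Γ : Finset Fml) (φ : Fml), (⟨Γ, φ⟩ : Infer) ∈ L →
    ∀ σ : ℕ → Fml, (⟨Γ.image (subst σ), subst σ φ⟩ : Infer) ∈ L

/-- The Tarskian closure: the least superset satisfying (R), (M), (T), (S). -/
def Tar (L : Set Infer) : Set Infer :=
  ⋂₀ {L' : Set Infer | L ⊆ L' ∧ PropR L' ∧ PropM L' ∧ TransClosed L' ∧ PropS L'}

/-- L⋆: the inferences whose premise set is an antitheorem of L or whose
conclusion is a theorem of L. -/
def starL (L : Set Infer) : Set Infer :=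
  {I | (∀ ψ : Fml, (⟨I.prem, ψ⟩ : Infer) ∈ L) ∨ (∀ Δ : Finset Fml, (⟨Δ, I.concl⟩ : Infer) ∈ L)}

/-- The propositional variables occurring in a formula. -/
def fvars : Fml → Finset ℕ
  | .var n => {n}
  | .neg φ => fvars φ
  | .conj φ ψ => fvars φ ∪ fvars ψ
  | .disj φ ψ => fvars φ ∪ fvars ψ

theorem subset_T (L : Set Infer) : L ⊆ T L := fun _ hI _ h => h.1 hI

theorem transClosed_T (L : Set Infer) : TransClosed (T L) :=
  fun Γ Δ φ hne hφ hδ L' h =>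
    h.2 Γ Δ φ hne (hφ L' h) fun δ hd => hδ δ hd L' h

theorem T_subset {L L' : Set Infer} (h : L ⊆ L') (ht : TransClosed L') : T L ⊆ L' :=
  fun _ hI => hI L' ⟨h, ht⟩

theorem subset_Tar (L : Set Infer) : L ⊆ Tar L := fun _ hI _ h => h.1 hI

theorem propR_Tar (L : Set Infer) : PropR (Tar L) := fun φ _ h => h.2.1 φ

theorem propM_Tar (L : Set Infer) : PropM (Tar L) :=
  fun Γ Sg φ hφ hs L' h => h.2.2.1 Γ Sg φ (hφ L' h) hs

theorem transClosed_Tar (L : Set Infer) : TransClosed (Tar L) :=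
  fun Γ Δ φ hne hφ hδ L' h =>
    h.2.2.2.1 Γ Δ φ hne (hφ L' h) fun δ hd => hδ δ hd L' h

theorem propS_Tar (L : Set Infer) : PropS (Tar L) :=
  fun Γ φ hφ σ L' h => h.2.2.2.2 Γ φ (hφ L' h) σ

theorem PropM.union {L₁ L₂ : Set Infer} (h₁ : PropM L₁) (h₂ : PropM L₂) :
    PropM (L₁ ∪ L₂) :=
  fun Γ Sg φ h hs => h.imp (h₁ Γ Sg φ · hs) (h₂ Γ Sg φ · hs)

theorem PropS.union {L₁ L₂ : Set Infer} (h₁ : PropS L₁) (h₂ : PropS L₂) :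
    PropS (L₁ ∪ L₂) :=
  fun Γ φ h σ => h.imp (h₁ Γ φ · σ) (h₂ Γ φ · σ)

/-- The transitive closure preserves monotonicity. -/
theorem PropM.T {L : Set Infer} (hM : PropM L) : PropM (T L) := by
  intro Γ Sg φ hφ hs
  have key : ThreeValued.T L ⊆
      {I : Infer | ∀ Sg, I.prem ⊆ Sg → (⟨Sg, I.concl⟩ : Infer) ∈ ThreeValued.T L} := by
    refine T_subset (fun I hI Sg hs => subset_T L (hM I.prem Sg I.concl hI hs)) ?_
    intro Γ Δ φ hne hφ hδ Sg hs
    exact transClosed_T L Sg Δ φ hne (hφ Δ subset_rfl) fun δ hd => hδ δ hd Sg hs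
  exact key hφ Sg hs

/-- The transitive closure preserves structurality. -/
theorem PropS.T {L : Set Infer} (hS : PropS L) : PropS (T L) := by
  intro Γ φ hφ σ
  have key : ThreeValued.T L ⊆ {I : Infer |
      (⟨I.prem.image (subst σ), subst σ I.concl⟩ : Infer) ∈ ThreeValued.T L} := by
    refine T_subset (fun I hI => subset_T L (hS I.prem I.concl hI σ)) ?_
    intro Γ Δ φ hne hφ hδ
    refine transClosed_T L _ (Δ.image (subst σ)) _ (hne.image _) hφ ?_
    intro ψ hψ
    obtain ⟨δ, hd, rfl⟩ := Finset.mem_image.mp hψ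
    exact hδ δ hd
  exact key hφ

/-- For Tarskian sets of inferences, the transitive closure of the union is
the Tarskian closure of the union. -/
theorem stmt14 : ∀ L₁ L₂ : Set Infer, L₁ = Tar L₁ → L₂ = Tar L₂ →
    T (L₁ ∪ L₂) = Tar (L₁ ∪ L₂) := by
  intro L₁ L₂ h₁ h₂
  have hR : PropR L₁ := h₁ ▸ propR_Tar L₁
  have hM : PropM (L₁ ∪ L₂) :=
    PropM.union (h₁ ▸ propM_Tar L₁) (h₂ ▸ propM_Tar L₂)
  have hS : PropS (L₁ ∪ L₂) :=
    PropS.union (h₁ ▸ propS_Tar L₁) (h₂ ▸ propS_Tar L₂)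
  apply Set.Subset.antisymm
  · exact T_subset (subset_Tar _) (transClosed_Tar _)
  · intro I hI
    exact hI _ ⟨subset_T _, fun φ => subset_T _ (Or.inl (hR φ)), hM.T,
      transClosed_T _, hS.T⟩

end ThreeValued
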